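/- arXiv:1407.2373 — 2 statements merged into one kernel-verified Lean document; each statement's English description precedes it below -/
import Mathlib

section
/- For an odd prime p, the discriminant of the maximal real subfield ℚ(ζ_p + ζ_p^{-1}) of the p-th cyclotomic field equals p^{(p-3)/2}. -/
open NumberField

open IntermediateField in
theorem NumberField.isTotallyReal_of_adjoin_add_inv {K L : Type*} [Field K]
    [NumberField K] [Field L] [NumberField L] [Algebra K L] {n : ℕ} [NeZero n] {ζ : L}
    (hζ : IsPrimitiveRoot ζ n) {a : K} (ha : algebraMap K L a = ζ + ζ⁻¹) (htop : ℚ⟮a⟯ = ⊤) :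
    IsTotallyReal K := by
  refine ⟨fun v ↦ InfinitePlace.isReal_iff.mpr ?_⟩
  set φ := v.embedding
  set ψ : L →+* ℂ := ComplexEmbedding.lift L φ
  have hψ (x : K) : ψ (algebraMap K L x) = φ x :=
    ComplexEmbedding.lift_algebraMap_apply L φ x
  have hconj : (starRingEnd ℂ) (ψ ζ) = (ψ ζ)⁻¹ :=
    (Complex.inv_eq_conj ((hζ.map_of_injective ψ.injective).norm'_eq_one (NeZero.ne n))).symm
  have hφa : (starRingEnd ℂ) (φ a) = φ a := by
    simp [← hψ, ha, hconj, add_comm]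
  have hext : ((starRingEnd ℂ).comp φ).toRatAlgHom = φ.toRatAlgHom := by
    have hle : (⊤ : IntermediateField ℚ K).toSubalgebra ≤
        AlgHom.equalizer ((starRingEnd ℂ).comp φ).toRatAlgHom φ.toRatAlgHom := by
      rw [← htop, adjoin_simple_toSubalgebra_of_isAlgebraic (Algebra.IsAlgebraic.isAlgebraic a)]
      exact Algebra.adjoin_le (by simpa [AlgHom.mem_equalizer] using hφa)
    exact AlgHom.ext fun x ↦ hle (Algebra.mem_top)
  rw [ComplexEmbedding.isReal_iff]
  ext x
  exact DFunLike.congr_fun hext x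

open Polynomial in
/-- A root of unity of order greater than two has the minimal polynomial `X ^ 2 - a X + 1` over a
totally real field containing `a = ζ + ζ⁻¹`. -/
theorem IsPrimitiveRoot.minpoly_eq_of_isTotallyReal {K L : Type*} [Field K] [NumberField K]
    [IsTotallyReal K] [Field L] [NumberField L] [Algebra K L] {n : ℕ} (hn : 2 < n) {ζ : L}
    (hζ : IsPrimitiveRoot ζ n) {a : K} (ha : algebraMap K L a = ζ + ζ⁻¹) :
    minpoly K ζ = X ^ 2 - C a * X + 1 := by
  have hζ0 : ζ ≠ 0 := hζ.ne_zero (by omega)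
  have hmonic : (X ^ 2 - C a * X + 1 : K[X]).Monic := by monicity!
  have hdeg : (X ^ 2 - C a * X + 1 : K[X]).natDegree = 2 := by compute_degree!
  have hint : IsIntegral K ζ := Algebra.IsIntegral.isIntegral ζ
  refine (eq_of_monic_of_dvd_of_natDegree_le (minpoly.monic hint) hmonic
    (minpoly.dvd _ _ ?_) ?_).symm
  · simp only [map_add, map_sub, map_pow, aeval_X, map_mul, aeval_C, ha, map_one]
    field_simp
    ring
  · rw [hdeg]
    by_contra! hlt
    have hone : (minpoly K ζ).natDegree = 1 := by
      have := minpoly.natDegree_pos hint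
      omega
    obtain ⟨z, rfl⟩ := minpoly.natDegree_eq_one_iff.mp hone
    have hz : IsPrimitiveRoot z n := hζ.of_map_of_injective (algebraMap K L).injective
    let φ : K →+* ℂ := Classical.choice inferInstance
    have hreal : (starRingEnd ℂ) (φ z) = φ z :=
      DFunLike.congr_fun (ComplexEmbedding.isReal_iff.mp
        (IsTotallyReal.complexEmbedding_isReal φ)) z
    have hφz := hz.map_of_injective φ.injective
    rw [← Complex.inv_eq_conj (hφz.norm'_eq_one (by omega))] at hreal
    have hsq : φ z ^ 2 = 1 := by
      have h0 : φ z ≠ 0 := hφz.ne_zero (by omega)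
      nth_rewrite 1 [sq, ← hreal]
      exact inv_mul_cancel₀ h0
    have := Nat.le_of_dvd two_pos (hφz.dvd_of_pow_eq_one 2 hsq)
    omega

open Polynomial in
theorem NumberField.absNorm_differentIdeal_dvd_of_isCyclotomicExtension {K L : Type*} [Field K]
    [NumberField K] [IsTotallyReal K] [Field L] [NumberField L] [Algebra K L] {p : ℕ}
    [hp : Fact p.Prime] (hp2 : p ≠ 2) [IsCyclotomicExtension {p} ℚ L] {ζ : L}
    (hζ : IsPrimitiveRoot ζ p) {a : K} (ha : algebraMap K L a = ζ + ζ⁻¹)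
    (htop : Algebra.adjoin K {ζ} = ⊤) :
    Ideal.absNorm (differentIdeal (𝓞 K) (𝓞 L)) ∣ p := by
  have hp3 : 2 < p := lt_of_le_of_ne hp.out.two_le hp2.symm
  have hmem := aeval_derivative_mem_differentIdeal (𝓞 K) K L hζ.toInteger htop
  set x := aeval hζ.toInteger (derivative (minpoly (𝓞 K) hζ.toInteger))
  have hx : (x : L) = ζ - ζ⁻¹ := by
    have hmin := minpoly.isIntegrallyClosed_eq_field_fractions K L
      (Algebra.IsIntegral.isIntegral (R := 𝓞 K) hζ.toInteger)
    have hcoe : algebraMap (𝓞 L) L hζ.toInteger = ζ := rfl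
    change algebraMap (𝓞 L) L x = _
    rw [← aeval_algebraMap_apply, ← aeval_map_algebraMap K, ← derivative_map, ← hmin, hcoe,
      hζ.minpoly_eq_of_isTotallyReal hp3 ha]
    simp [ha]
    ring
  have hsq : IsPrimitiveRoot (ζ ^ 2) p :=
    hζ.pow_of_coprime 2 ((Nat.coprime_primes Nat.prime_two hp.out).mpr hp2.symm)
  have hmul : hζ.toInteger * x = hsq.toInteger - 1 := by
    apply RingOfIntegers.ext
    have hζ0 : ζ ≠ 0 := hζ.ne_zero hp.out.ne_zero
    change ζ * (x : L) = ζ ^ 2 - 1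
    rw [hx]
    field_simp
  have hnorm : Algebra.norm ℤ (hsq.toInteger - 1) = p :=
    hsq.norm_toInteger_sub_one_of_prime_ne_two' hp2
  have hdvd := Ideal.absNorm_dvd_norm_of_mem
    (Ideal.mul_mem_left _ hζ.toInteger hmem)
  rw [hmul, hnorm] at hdvd
  exact_mod_cast hdvd

theorem Nat.Prime.eq_pow_of_pow_eq_mul_sq {p N d : ℕ} (hp : p.Prime) (hodd : Odd p) (hN : N ∣ p)
    (h : p ^ (p - 2) = N * d ^ 2) : d = p ^ ((p - 3) / 2) := by
  obtain ⟨j, -, rfl⟩ := (Nat.dvd_prime_pow hp).mp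
    (h ▸ (dvd_pow_self d two_ne_zero).mul_left N : d ∣ p ^ (p - 2))
  obtain ⟨m, rfl⟩ := hodd
  rw [← pow_mul] at h
  congr 1
  rcases (Nat.dvd_prime hp).mp hN with rfl | rfl
  · rw [one_mul] at h
    have := Nat.pow_right_injective hp.two_le h
    have := hp.two_le
    omega
  · rw [← pow_succ'] at h
    have := Nat.pow_right_injective hp.two_le h
    omega

open IntermediateField in
theorem NumberField.discr_of_adjoin_add_inv {K L : Type*} [Field K]
    [NumberField K] [Field L] [NumberField L] [Algebra K L] {p : ℕ} (hp : p.Prime) (hodd : Odd p)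
    [IsCyclotomicExtension {p} ℚ L] {ζ : L} (hζ : IsPrimitiveRoot ζ p) {a : K}
    (ha : algebraMap K L a = ζ + ζ⁻¹) (htop : ℚ⟮a⟯ = ⊤) :
    discr K = (p : ℤ) ^ ((p - 3) / 2) := by
  have : Fact p.Prime := ⟨hp⟩
  have hp2 : p ≠ 2 := by rintro rfl; exact absurd hodd (by decide)
  have hp3 : 2 < p := lt_of_le_of_ne hp.two_le hp2.symm
  have : IsTotallyReal K := isTotallyReal_of_adjoin_add_inv hζ ha htop
  have hadj : Algebra.adjoin K {ζ} = ⊤ := by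
    have h := IsCyclotomicExtension.adjoin_primitive_root_eq_top (A := ℚ) hζ
    refine top_le_iff.mp fun x _ ↦ ?_
    have hle : Algebra.adjoin ℚ {ζ} ≤ (Algebra.adjoin K {ζ}).restrictScalars ℚ :=
      Algebra.adjoin_le Algebra.subset_adjoin
    exact hle (h ▸ Algebra.mem_top)
  have hrank : Module.finrank K L = 2 := by
    have hint : IsIntegral K ζ := Algebra.IsIntegral.isIntegral ζ
    have hKtop : K⟮ζ⟯ = ⊤ := by
      rw [← toSubalgebra_inj, adjoin_simple_toSubalgebra_of_isAlgebraic hint.isAlgebraic, hadj,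
        top_toSubalgebra]
    rw [← finrank_top' (F := K) (E := L), ← hKtop, adjoin.finrank hint,
      hζ.minpoly_eq_of_isTotallyReal hp3 ha]
    compute_degree!
  have hdiscr := natAbs_discr_eq_absNorm_differentIdeal_mul_natAbs_discr_pow K (𝓞 K) L (𝓞 L)
  rw [hrank, IsCyclotomicExtension.Rat.discr_prime p L, Int.natAbs_mul, Int.natAbs_pow,
    Int.natAbs_pow, Int.natAbs_neg, Int.natAbs_one, one_pow, one_mul, Int.natAbs_natCast] at hdiscr
  have habs := hp.eq_pow_of_pow_eq_mul_sq hodd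
    (absNorm_differentIdeal_dvd_of_isCyclotomicExtension hp2 hζ ha hadj) hdiscr
  have hsign := sign_discr K
  rw [IsTotallyReal.nrComplexPlaces_eq_zero, pow_zero] at hsign
  rw [← Int.sign_mul_natAbs (discr K), hsign, habs]
  simp

theorem IntermediateField.adjoin_simple_eq_top_of_eq_adjoin {F E : Type*} [Field F] [Field E]
    [Algebra F E] (K : IntermediateField F E) {x : E} (hK : K = adjoin F {x}) (hx : x ∈ K) :
    adjoin F {(⟨x, hx⟩ : K)} = ⊤ := by
  apply map_injective K.val
  rw [adjoin_map, Set.image_singleton, ← AlgHom.fieldRange_eq_map, fieldRange_val]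
  exact hK.symm

/-- For an odd prime `p`, the discriminant of the maximal real subfield
`ℚ(ζ_p + ζ_p⁻¹)` of the `p`-th cyclotomic field is `p ^ ((p - 3) / 2)`. -/
theorem discr_maximal_real_subfield (p : ℕ) (hp : p.Prime) (hodd : Odd p)
    (ζ : ℂ) (hζ : IsPrimitiveRoot ζ p)
    (K : IntermediateField ℚ ℂ) (hK : K = IntermediateField.adjoin ℚ {ζ + ζ⁻¹}) [NumberField K] :
    discr K = (p : ℤ) ^ ((p - 3) / 2) := by
  have : NeZero p := ⟨hp.ne_zero⟩
  let L : IntermediateField ℚ ℂ := IntermediateField.adjoin ℚ {ζ}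
  have hζL : ζ ∈ L := IntermediateField.mem_adjoin_simple_self ℚ ζ
  have : IsCyclotomicExtension {p} ℚ L :=
    (IntermediateField.isCyclotomicExtension_singleton_iff_eq_adjoin p ℚ ℂ L hζ).mpr rfl
  have : NumberField L := IsCyclotomicExtension.numberField {p} ℚ L
  have hζ' : IsPrimitiveRoot (⟨ζ, hζL⟩ : L) p := IsPrimitiveRoot.coe_submonoidClass_iff.mp hζ
  have hKL : K ≤ L := by
    rw [hK, IntermediateField.adjoin_simple_le_iff]
    exact add_mem hζL (inv_mem hζL)
  have haK : ζ + ζ⁻¹ ∈ K := hK ▸ IntermediateField.mem_adjoin_simple_self ℚ _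
  let : Algebra K L := (IntermediateField.inclusion hKL).toRingHom.toAlgebra
  refine discr_of_adjoin_add_inv (L := L) hp hodd hζ'
    (a := (⟨ζ + ζ⁻¹, haK⟩ : K)) rfl ?_
  exact K.adjoin_simple_eq_top_of_eq_adjoin hK haK
end

section
/- For an odd prime p, let O = ℤ[ζ_p + ζ_p^{-1}] and let x ∈ O have norm divisible by p. Then x/(2 - (ζ_p + ζ_p^{-1})) is an element of O with absolute norm |N(x)|/p. -/
section Cyclotomic

open NumberField Module

variable {K L : Type*} [Field K] [Field L] [Algebra K L]
  {p : ℕ} [hp : Fact p.Prime] {ζ : L} {y : 𝓞 K}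

theorem two_sub_add_inv_eq_mul {F : Type*} [Field F] {z : F} (hz : z ≠ 0) :
    2 - (z + z⁻¹) = (z - 1) * (z⁻¹ - 1) := by
  field_simp
  ring

/-- Every prime ideal above `p` contains `2 - (ζ + ζ⁻¹)`. -/
theorem two_sub_add_inv_mem_of_mem (hζ : IsPrimitiveRoot ζ p)
    (hy : algebraMap K L y = 2 - (ζ + ζ⁻¹)) (P : Ideal (𝓞 K)) [P.IsMaximal]
    (hP : (p : 𝓞 K) ∈ P) : y ∈ P := by
  obtain ⟨Q, hQ, hQP⟩ := Ideal.exists_maximal_ideal_liesOver_of_isIntegral P (S := 𝓞 L)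
  have hpQ : (p : 𝓞 L) ∈ Q := by
    simpa using (Q.mem_of_liesOver P (p : 𝓞 K)).mp hP
  rw [Q.mem_of_liesOver P]
  have h1 : hζ.toInteger - 1 ∈ Q :=
    hQ.isPrime.mem_of_pow_mem _ <| Q.mem_of_dvd
      (IsCyclotomicExtension.Rat.associated_zeta_sub_one_pow_prime p hζ).symm.dvd hpQ
  have : algebraMap (𝓞 K) (𝓞 L) y = (hζ.toInteger - 1) * (hζ.inv.toInteger - 1) := by
    apply RingOfIntegers.ext
    exact hy.trans (two_sub_add_inv_eq_mul (hζ.ne_zero hp.out.ne_zero))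
  rw [this]
  exact Q.mul_mem_right _ h1

variable [NumberField K] [NumberField L] [hL : IsCyclotomicExtension {p} ℚ L]

/-- The norm of `2 - (ζ + ζ⁻¹)` from a proper subfield of `ℚ(ζ)` containing it is `± p`. -/
theorem absNorm_span_two_sub_add_inv (hodd : p ≠ 2) (hζ : IsPrimitiveRoot ζ p)
    (hK : ¬ Function.Surjective (algebraMap K L))
    (hy : algebraMap K L y = 2 - (ζ + ζ⁻¹)) :
    Ideal.absNorm (Ideal.span {y}) = p := by
  have norm_sub_one (η : L) (hη : IsPrimitiveRoot η p) : Algebra.norm ℚ (η - 1) = p :=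
    hη.norm_sub_one_of_prime_ne_two' (Polynomial.cyclotomic.irreducible_rat hp.out.pos) hodd
  have h : Algebra.norm ℚ (y : K) ^ finrank K L = (p : ℚ) ^ 2 := by
    rw [← map_pow, ← Algebra.norm_algebraMap, Algebra.norm_norm, hy,
      two_sub_add_inv_eq_mul (hζ.ne_zero hp.out.ne_zero), map_mul,
      norm_sub_one _ hζ, norm_sub_one _ hζ.inv, sq]
  rw [← Algebra.coe_norm_int] at h
  have h' : (Algebra.norm ℤ y).natAbs ^ finrank K L = p ^ 2 := by
    rw [← Int.natAbs_pow, show Algebra.norm ℤ y ^ finrank K L = (p : ℤ) ^ 2 by exact_mod_cast h]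
    simp [Int.natAbs_pow]
  rw [Ideal.absNorm_span_singleton]
  have hfin : finrank K L ≠ 1 := fun h1 ↦ hK <| by
    have := (Subalgebra.bot_eq_top_iff_finrank_eq_one (F := K) (E := L)).mpr h1
    exact (Algebra.surjective_algebraMap_iff).mpr this.symm
  have hpos : finrank K L ≠ 0 := finrank_pos.ne'
  obtain ⟨k, -, hk⟩ := (Nat.dvd_prime_pow hp.out).mp (h' ▸ dvd_pow_self _ hpos)
  rw [hk, ← pow_mul] at h'
  have hk2 := Nat.pow_right_injective hp.out.two_le h'
  have : finrank K L = 2 :=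
    ((Nat.dvd_prime Nat.prime_two).mp ⟨k, by rw [mul_comm, hk2]⟩).resolve_left hfin
  have : k = 1 := by rw [this] at hk2; omega
  rw [hk, this, pow_one]

theorem two_sub_add_inv_dvd_of_dvd_norm (hodd : p ≠ 2) (hζ : IsPrimitiveRoot ζ p)
    (hK : ¬ Function.Surjective (algebraMap K L))
    (hy : algebraMap K L y = 2 - (ζ + ζ⁻¹)) {x : 𝓞 K} (hx : (p : ℤ) ∣ Algebra.norm ℤ x) :
    y ∣ x := by
  have hN := absNorm_span_two_sub_add_inv hodd hζ hK hy
  have hbot : Ideal.span {y} ≠ ⊥ := fun h ↦ hp.out.ne_zero <| by rw [← hN, h, Ideal.absNorm_bot]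
  have hmax : (Ideal.span {y}).IsMaximal :=
    (Ideal.isPrime_of_irreducible_absNorm (hN ▸ hp.out)).isMaximal hbot
  obtain ⟨P, hP, hPp, hPx⟩ := Ideal.exists_isMaximal_dvd_of_dvd_absNorm' hp.out (Ideal.span {x})
    (by rw [Ideal.absNorm_span_singleton]; exact Int.natCast_dvd.mp hx)
  have hpP : (p : 𝓞 K) ∈ P := by
    have : (p : ℤ) ∈ P.under ℤ := hPp ▸ Ideal.mem_span_singleton_self _
    simpa [Ideal.under_def] using this
  have hyP := two_sub_add_inv_mem_of_mem hζ hy P hpP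
  rw [← Ideal.mem_span_singleton,
    hmax.eq_of_le hP.ne_top ((Ideal.span_singleton_le_iff_mem P).mpr hyP),
    ← Ideal.span_singleton_le_iff_mem]
  exact Ideal.le_of_dvd hPx

end Cyclotomic

theorem add_inv_mem_adjoin_simple (F : Type*) {E : Type*} [Field F] [Field E] [Algebra F E]
    (z : E) : z + z⁻¹ ∈ IntermediateField.adjoin F {z} :=
  add_mem (IntermediateField.mem_adjoin_simple_self F z)
    (inv_mem (IntermediateField.mem_adjoin_simple_self F z))

theorem Complex.not_mem_adjoin_add_inv {ζ : ℂ} {n : ℕ} (hn : 2 < n) (hζ : IsPrimitiveRoot ζ n) :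
    ζ ∉ IntermediateField.adjoin ℚ {ζ + ζ⁻¹} := by
  have hinv : ζ⁻¹ = starRingEnd ℂ ζ := Complex.inv_eq_conj (hζ.norm'_eq_one (by omega))
  have hle : IntermediateField.adjoin ℚ {ζ + ζ⁻¹} ≤
      (Complex.ofRealAm.restrictScalars ℚ).fieldRange := by
    rw [IntermediateField.adjoin_simple_le_iff, hinv, Complex.add_conj]
    exact ⟨2 * ζ.re, rfl⟩
  intro hmem
  obtain ⟨r, hr⟩ := hle hmem
  have hconj : ζ⁻¹ = ζ := by
    rw [hinv, ← hr]
    exact Complex.conj_ofReal r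
  have hsq : ζ ^ 2 = 1 := by
    rw [sq]
    nth_rewrite 1 [← hconj]
    exact inv_mul_cancel₀ (hζ.ne_zero (by omega))
  exact absurd (Nat.le_of_dvd two_pos (hζ.dvd_of_pow_eq_one 2 hsq)) (by omega)

/-- Let `p` be an odd prime, `O = ℤ[ζ_p + ζ_p⁻¹]` the ring of integers of
`K = ℚ(ζ_p + ζ_p⁻¹)`, and `x ∈ O` with norm divisible by `p`.  Then
`x / (2 - (ζ_p + ζ_p⁻¹))` lies in `O` and has absolute norm `|N(x)| / p`. -/
theorem divide_by_ramified_element (p : ℕ) (hp : p.Prime) (hodd : Odd p)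
    (ζ : ℂ) (hζ : IsPrimitiveRoot ζ p)
    (K : IntermediateField ℚ ℂ) (hK : K = IntermediateField.adjoin ℚ {ζ + ζ⁻¹})
    [NumberField K] (x : K) (hx : IsIntegral ℤ x)
    (hdvd : ∃ m : ℤ, Algebra.norm ℚ x = (p : ℚ) * m)
    (y : K) (hy : (y : ℂ) = 2 - (ζ + ζ⁻¹)) :
    IsIntegral ℤ (x / y) ∧
      |Algebra.norm ℚ (x / y)| = |Algebra.norm ℚ x| / p := by
  have : Fact p.Prime := ⟨hp⟩
  have hp2 : p ≠ 2 := by rintro rfl; exact absurd hodd (by decide)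
  let L := IntermediateField.adjoin ℚ {ζ}
  have hζint : IsIntegral ℤ ζ := hζ.isIntegral hp.pos
  have hfin : FiniteDimensional ℚ L := IntermediateField.adjoin.finiteDimensional hζint.tower_top
  have : NumberField L := ⟨⟩
  let ζL : L := IntermediateField.AdjoinSimple.gen ℚ ζ
  have hζL : IsPrimitiveRoot ζL p := IsPrimitiveRoot.coe_submonoidClass_iff.mp hζ
  have : IsCyclotomicExtension {p} ℚ L := by
    have halg : IsAlgebraic ℚ ζ := (hζint.tower_top (A := ℚ)).isAlgebraic
    change IsCyclotomicExtension {p} ℚ L.toSubalgebra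
    rw [IntermediateField.adjoin_simple_toSubalgebra_of_isAlgebraic halg]
    exact hζ.adjoin_isCyclotomicExtension ℚ
  have hKL : K ≤ L := by
    rw [hK, IntermediateField.adjoin_simple_le_iff]
    exact add_inv_mem_adjoin_simple ℚ ζ
  let _ : Algebra K L := (IntermediateField.inclusion hKL).toRingHom.toAlgebra
  have hsurj : ¬ Function.Surjective (algebraMap K L) := fun h ↦ by
    obtain ⟨z, hz⟩ := h ζL
    refine Complex.not_mem_adjoin_add_inv (lt_of_le_of_ne hp.two_le hp2.symm) hζ ?_
    have hzζ : (z : ℂ) = ζ := congrArg Subtype.val hz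
    rw [← hK, ← hzζ]
    exact z.2
  have hyL : algebraMap K L y = 2 - (ζL + ζL⁻¹) := Subtype.ext hy
  have hyint : IsIntegral ℤ y := by
    rw [← isIntegral_algebraMap_iff (FaithfulSMul.algebraMap_injective K ℂ)]
    change IsIntegral ℤ (y : ℂ)
    rw [hy]
    have h2 : IsIntegral ℤ (2 : ℂ) := by
      simpa using isIntegral_algebraMap (R := ℤ) (A := ℂ) (x := 2)
    exact h2.sub (hζint.add (hζ.inv.isIntegral hp.pos))
  let x' : NumberField.RingOfIntegers K := ⟨x, hx⟩
  let y' : NumberField.RingOfIntegers K := ⟨y, hyint⟩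
  have hN : |Algebra.norm ℚ y| = p := by
    have h := absNorm_span_two_sub_add_inv (y := y') hp2 hζL hsurj hyL
    rw [Ideal.absNorm_span_singleton] at h
    change |Algebra.norm ℚ (y' : K)| = p
    rw [← Algebra.coe_norm_int, ← Int.cast_abs, Int.abs_eq_natAbs, h, Int.cast_natCast]
  have hy0 : y ≠ 0 := by
    rintro rfl
    rw [Algebra.norm_zero, abs_zero] at hN
    exact hp.ne_zero (by exact_mod_cast hN.symm)
  refine ⟨?_, ?_⟩
  swap
  · rw [eq_div_iff (by exact_mod_cast hp.ne_zero), ← hN, ← abs_mul, ← map_mul,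
      div_mul_cancel₀ _ hy0]
  obtain ⟨m, hm⟩ := hdvd
  obtain ⟨z, hz⟩ := two_sub_add_inv_dvd_of_dvd_norm (y := y') (x := x') hp2 hζL hsurj hyL
    ⟨m, by
      change Algebra.norm ℚ (x' : K) = _ at hm
      rw [← Algebra.coe_norm_int] at hm
      exact_mod_cast hm⟩
  have hzx : x = y * z := congrArg (algebraMap (NumberField.RingOfIntegers K) K) hz
  rw [hzx, mul_div_cancel_left₀ _ hy0]
  exact z.isIntegral_coe
end
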